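/- arXiv:math/0202183 — 12 statements merged into one kernel-verified Lean document; each statement's English description precedes it below -/
import Mathlib

section
/- For every real q > 0 and all colour parameters λ, μ, ν ∈ ℝ, the coloured R-matrix satisfies the coloured quantum Yang–Baxter equation R₁₂(λ,μ) · R₁₃(λ,ν) · R₂₃(μ,ν) = R₂₃(μ,ν) · R₁₃(λ,ν) · R₁₂(λ,μ) as an identity of 8×8 real matrices, where for a 4×4 matrix M with rows and columns indexed by pairs in {1,2}² the 8×8 matrices indexed by triples in {1,2}³ are defined entrywise by M₁₂[(i,j,k),(i',j',k')] = M[(i,j),(i',j')]·δ_{k,k'}, M₂₃[(i,j,k),(i',j',k')] = δ_{i,i'}·M[(j,k),(j',k')], and M₁₃[(i,j,k),(i',j',k')] = δ_{j,j'}·M[(i,k),(i',k')]. -/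
/-- The coloured R-matrix `R(λ,μ)` of `GL_q^{λ,μ}(2)`, a 4×4 real matrix with rows
and columns indexed by pairs in `{1,2}²` (here `Fin 2 × Fin 2`, with `0 ↔ 1`, `1 ↔ 2`),
ordered `(1,1),(1,2),(2,1),(2,2)`. -/
noncomputable def colouredR (q l m : ℝ) : Matrix (Fin 2 × Fin 2) (Fin 2 × Fin 2) ℝ :=
  Matrix.of fun p r =>
    if p = ((0 : Fin 2), (0 : Fin 2)) ∧ r = ((0 : Fin 2), (0 : Fin 2)) then q ^ (1 - l + m)
    else if p = ((0 : Fin 2), (1 : Fin 2)) ∧ r = ((0 : Fin 2), (1 : Fin 2)) then q ^ (l + m)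
    else if p = ((1 : Fin 2), (0 : Fin 2)) ∧ r = ((0 : Fin 2), (1 : Fin 2)) then q - q⁻¹
    else if p = ((1 : Fin 2), (0 : Fin 2)) ∧ r = ((1 : Fin 2), (0 : Fin 2)) then q ^ (-l - m)
    else if p = ((1 : Fin 2), (1 : Fin 2)) ∧ r = ((1 : Fin 2), (1 : Fin 2)) then q ^ (1 + l - m)
    else 0

/-- For a 4×4 matrix `M` indexed by pairs, the 8×8 matrix `M₁₂` indexed by triples:
`M₁₂[(i,j,k),(i',j',k')] = M[(i,j),(i',j')]·δ_{k,k'}`. -/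
def leg12 (M : Matrix (Fin 2 × Fin 2) (Fin 2 × Fin 2) ℝ) :
    Matrix (Fin 2 × Fin 2 × Fin 2) (Fin 2 × Fin 2 × Fin 2) ℝ :=
  Matrix.of fun p r => M (p.1, p.2.1) (r.1, r.2.1) * (if p.2.2 = r.2.2 then 1 else 0)

/-- `M₂₃[(i,j,k),(i',j',k')] = δ_{i,i'}·M[(j,k),(j',k')]`. -/
def leg23 (M : Matrix (Fin 2 × Fin 2) (Fin 2 × Fin 2) ℝ) :
    Matrix (Fin 2 × Fin 2 × Fin 2) (Fin 2 × Fin 2 × Fin 2) ℝ :=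
  Matrix.of fun p r => (if p.1 = r.1 then 1 else 0) * M (p.2.1, p.2.2) (r.2.1, r.2.2)

/-- `M₁₃[(i,j,k),(i',j',k')] = δ_{j,j'}·M[(i,k),(i',k')]`. -/
def leg13 (M : Matrix (Fin 2 × Fin 2) (Fin 2 × Fin 2) ℝ) :
    Matrix (Fin 2 × Fin 2 × Fin 2) (Fin 2 × Fin 2 × Fin 2) ℝ :=
  Matrix.of fun p r => (if p.2.1 = r.2.1 then 1 else 0) * M (p.1, p.2.2) (r.1, r.2.2)

set_option maxHeartbeats 4000000 in
/-- The coloured R-matrix satisfies the coloured quantum Yang–Baxter equation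
`R₁₂(λ,μ) · R₁₃(λ,ν) · R₂₃(μ,ν) = R₂₃(μ,ν) · R₁₃(λ,ν) · R₁₂(λ,μ)`. -/
theorem colouredR_quantum_yang_baxter (q : ℝ) (hq : 0 < q) (l m n : ℝ) :
    leg12 (colouredR q l m) * leg13 (colouredR q l n) * leg23 (colouredR q m n) =
      leg23 (colouredR q m n) * leg13 (colouredR q l n) * leg12 (colouredR q l m) := by
  have rpow_diag₀ (x y : ℝ) : q ^ (1 - x + y) = q * (q ^ x)⁻¹ * q ^ y := by
    rw [Real.rpow_add hq, Real.rpow_sub hq, Real.rpow_one, div_eq_mul_inv]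
  have rpow_diag₃ (x y : ℝ) : q ^ (1 + x - y) = q * q ^ x * (q ^ y)⁻¹ := by
    rw [Real.rpow_sub hq, Real.rpow_add hq, Real.rpow_one, div_eq_mul_inv]
  have rpow_diag₂ (x y : ℝ) : q ^ (-x - y) = (q ^ x)⁻¹ * (q ^ y)⁻¹ := by
    rw [Real.rpow_sub hq, Real.rpow_neg hq.le, div_eq_mul_inv]
  have hl := (Real.rpow_pos_of_pos hq l).ne'
  have hm := (Real.rpow_pos_of_pos hq m).ne'
  have hn := (Real.rpow_pos_of_pos hq n).ne'
  ext ⟨i, j, k⟩ ⟨a, b, c⟩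
  fin_cases i <;> fin_cases j <;> fin_cases k <;>
    fin_cases a <;> fin_cases b <;> fin_cases c <;>
    simp [Matrix.mul_apply, Fintype.sum_prod_type, leg12, leg13, leg23, colouredR,
      rpow_diag₀, rpow_diag₂, rpow_diag₃, Real.rpow_add hq] <;>
    field_simp <;> ring
end

section
/- For every real q > 0 and all colour parameters λ, μ, ν ∈ ℝ, the coloured braided R-matrix satisfies the coloured braided Yang–Baxter (braid) equation (R̂(μ,ν) ⊗ I₂) · (I₂ ⊗ R̂(λ,ν)) · (R̂(λ,μ) ⊗ I₂) = (I₂ ⊗ R̂(λ,μ)) · (R̂(λ,ν) ⊗ I₂) · (I₂ ⊗ R̂(μ,ν)) as an identity of 8×8 real matrices, where ⊗ denotes the Kronecker product and I₂ is the 2×2 identity matrix. -/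
open Kronecker

/-- The coloured braided R-matrix `R̂(λ,μ)` (the flip composed with the coloured
R-matrix), a 4×4 real matrix with rows and columns indexed by pairs in `Fin 2 × Fin 2`
ordered `(1,1),(1,2),(2,1),(2,2)`. -/
noncomputable def colouredRhat (q l m : ℝ) : Matrix (Fin 2 × Fin 2) (Fin 2 × Fin 2) ℝ :=
  Matrix.of fun p r =>
    if p = ((0 : Fin 2), (0 : Fin 2)) ∧ r = ((0 : Fin 2), (0 : Fin 2)) then q ^ (1 - l + m)
    else if p = ((0 : Fin 2), (1 : Fin 2)) ∧ r = ((0 : Fin 2), (1 : Fin 2)) then q - q⁻¹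
    else if p = ((0 : Fin 2), (1 : Fin 2)) ∧ r = ((1 : Fin 2), (0 : Fin 2)) then q ^ (-l - m)
    else if p = ((1 : Fin 2), (0 : Fin 2)) ∧ r = ((0 : Fin 2), (1 : Fin 2)) then q ^ (l + m)
    else if p = ((1 : Fin 2), (1 : Fin 2)) ∧ r = ((1 : Fin 2), (1 : Fin 2)) then q ^ (1 + l - m)
    else 0

/-- `M ⊗ I₂` as an 8×8 matrix indexed by `(Fin 2 × Fin 2) × Fin 2`. -/
noncomputable def tensI (M : Matrix (Fin 2 × Fin 2) (Fin 2 × Fin 2) ℝ) :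
    Matrix ((Fin 2 × Fin 2) × Fin 2) ((Fin 2 × Fin 2) × Fin 2) ℝ :=
  M ⊗ₖ (1 : Matrix (Fin 2) (Fin 2) ℝ)

/-- `I₂ ⊗ M` as an 8×8 matrix, reindexed (via associativity of the product) to be
indexed by `(Fin 2 × Fin 2) × Fin 2`. -/
noncomputable def Itens (M : Matrix (Fin 2 × Fin 2) (Fin 2 × Fin 2) ℝ) :
    Matrix ((Fin 2 × Fin 2) × Fin 2) ((Fin 2 × Fin 2) × Fin 2) ℝ :=
  Matrix.reindex (Equiv.prodAssoc (Fin 2) (Fin 2) (Fin 2)).symm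
    (Equiv.prodAssoc (Fin 2) (Fin 2) (Fin 2)).symm
    ((1 : Matrix (Fin 2) (Fin 2) ℝ) ⊗ₖ M)

set_option maxHeartbeats 4000000 in
/-- The coloured braided R-matrix satisfies the coloured braided Yang–Baxter (braid)
equation `(R̂(μ,ν) ⊗ I₂)(I₂ ⊗ R̂(λ,ν))(R̂(λ,μ) ⊗ I₂) =
(I₂ ⊗ R̂(λ,μ))(R̂(λ,ν) ⊗ I₂)(I₂ ⊗ R̂(μ,ν))`. -/
theorem colouredRhat_braid (q : ℝ) (hq : 0 < q) (l m n : ℝ) :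
    tensI (colouredRhat q m n) * Itens (colouredRhat q l n) * tensI (colouredRhat q l m) =
      Itens (colouredRhat q l m) * tensI (colouredRhat q l n) * Itens (colouredRhat q m n) := by
  have hl : q ^ l ≠ 0 := (Real.rpow_pos_of_pos hq l).ne'
  have hm : q ^ m ≠ 0 := (Real.rpow_pos_of_pos hq m).ne'
  have hn : q ^ n ≠ 0 := (Real.rpow_pos_of_pos hq n).ne'
  have hq0 : q ≠ 0 := hq.ne'
  ext ⟨⟨i, j⟩, k⟩ ⟨⟨i', j'⟩, k'⟩
  fin_cases i <;> fin_cases j <;> fin_cases k <;>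
    fin_cases i' <;> fin_cases j' <;> fin_cases k' <;>
    simp [tensI, Itens, colouredRhat, Matrix.mul_apply, Fintype.sum_prod_type, Matrix.one_apply,
      Real.rpow_add hq, Real.rpow_sub hq, Real.rpow_neg hq.le] <;>
    field_simp <;> ring
end

section
/- Under the coaction of the coloured quantum group on the coloured quantum plane, the first plane relation is preserved: x'_λ x'_μ = q^{λ−μ} x'_μ x'_λ. -/
/-- Under the coaction of `GL_q^{λ,μ}(2)` on the coloured quantum plane (with `x'_ν = a_ν x_ν + b_ν y_ν`, `y'_ν = c_ν x_ν + d_ν y_ν`), the first plane relation is preserved: `x'_λ x'_μ = q^{λ−μ} x'_μ x'_λ`. -/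
theorem coaction_preserves_plane_rel_xx {A : Type*} [Ring A] [Algebra ℝ A]
    (q : ℝ) (hq : 0 < q) (l m : ℝ)
    (al bl cl dl am bm cm dm : A) (xl yl xm ym : A)
    (h1 : al * bm = q ^ (1 + 2*l) • (bm * al))
    (h2 : al * cm = q ^ (1 - 2*l) • (cm * al))
    (h3 : bl * cm = q ^ (-(2*(l + m))) • (cm * bl))
    (h4 : bl * dm = q ^ (1 - 2*m) • (dm * bl))
    (h5 : dl * cm = q ^ (-1 - 2*l) • (cm * dl))
    (h6 : al * dm - dm * al = ((q - q⁻¹) * q ^ (l + m)) • (bm * cl))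
    (h7 : al * bm = q ^ (l - m) • (am * bl))
    (h8 : al * cm = q ^ (m - l) • (am * cl))
    (h9 : bl * cm = bm * cl)
    (h10 : bl * dm = q ^ (l - m) • (bm * dl))
    (h11 : cl * dm = q ^ (m - l) • (cm * dl))
    (h12 : al * dm = am * dl)
    (h13 : al * am = am * al)
    (h14 : bl * bm = q ^ (2*(l - m)) • (bm * bl))
    (h15 : cl * cm = q ^ (2*(m - l)) • (cm * cl))
    (h16 : dl * dm = dm * dl)
    (h17 : am * bl = q ^ (1 + 2*m) • (bl * am))
    (h18 : am * cl = q ^ (1 - 2*m) • (cl * am))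
    (h19 : bm * cl = q ^ (-(2*(m + l))) • (cl * bm))
    (h20 : bm * dl = q ^ (1 - 2*l) • (dl * bm))
    (h21 : dm * cl = q ^ (-1 - 2*m) • (cl * dm))
    (h22 : am * dl - dl * am = ((q - q⁻¹) * q ^ (m + l)) • (bl * cm))
    (h23 : am * bl = q ^ (m - l) • (al * bm))
    (h24 : am * cl = q ^ (l - m) • (al * cm))
    (h25 : bm * cl = bl * cm)
    (h26 : bm * dl = q ^ (m - l) • (bl * dm))
    (h27 : cm * dl = q ^ (l - m) • (cl * dm))
    (h28 : am * dl = al * dm)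
    (h29 : am * al = al * am)
    (h30 : bm * bl = q ^ (2*(m - l)) • (bl * bm))
    (h31 : cm * cl = q ^ (2*(l - m)) • (cl * cm))
    (h32 : dm * dl = dl * dm)
    (hp1 : xl * xm = q ^ (l - m) • (xm * xl))
    (hp2 : xl * ym = q ^ (1 - l - m) • (ym * xl))
    (hp3 : xm * yl = q ^ (1 - l - m) • (yl * xm))
    (hp4 : xl * ym = xm * yl)
    (hp5 : yl * ym = q ^ (m - l) • (ym * yl))
    (hcomm : ∀ g ∈ ({al, bl, cl, dl, am, bm, cm, dm} : Set A),
      ∀ z ∈ ({xl, yl, xm, ym} : Set A), Commute g z) :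
    (al * xl + bl * yl) * (am * xm + bm * ym) = q ^ (l - m) • ((am * xm + bm * ym) * (al * xl + bl * yl)) := by
  have hpos (t : ℝ) : q ^ t ≠ 0 := (Real.rpow_pos_of_pos hq t).ne'
  have hyx : yl * xm = ym * xl :=
    smul_right_injective A (hpos (1 - l - m)) (by simp only [← hp2, ← hp3, hp4])
  have hba : bl * am = q ^ (l - m) • (bm * al) := by
    apply smul_right_injective A (hpos (1 + 2 * m))
    simp only
    rw [← h17, h23, h1, smul_smul, smul_smul, ← Real.rpow_add hq, ← Real.rpow_add hq]
    ring_nf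
  have hbb : (bl * bm) * (yl * ym) = q ^ (l - m) • ((bm * bl) * (ym * yl)) := by
    rw [h14, hp5, smul_mul_smul_comm, ← Real.rpow_add hq]
    ring_nf
  have h_am_xl := (hcomm am (by simp) xl (by simp)).symm
  have h_bm_xl := (hcomm bm (by simp) xl (by simp)).symm
  have h_am_yl := (hcomm am (by simp) yl (by simp)).symm
  have h_bm_yl := (hcomm bm (by simp) yl (by simp)).symm
  have h_al_xm := (hcomm al (by simp) xm (by simp)).symm
  have h_bl_xm := (hcomm bl (by simp) xm (by simp)).symm
  have h_al_ym := (hcomm al (by simp) ym (by simp)).symm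
  have h_bl_ym := (hcomm bl (by simp) ym (by simp)).symm
  simp only [add_mul, mul_add, smul_add]
  rw [h_am_xl.mul_mul_mul_comm, h_bm_xl.mul_mul_mul_comm,
    h_am_yl.mul_mul_mul_comm, h_bm_yl.mul_mul_mul_comm,
    h_al_xm.mul_mul_mul_comm, h_bl_xm.mul_mul_mul_comm,
    h_al_ym.mul_mul_mul_comm, h_bl_ym.mul_mul_mul_comm,
    hbb, hba, hyx, h13, hp1, h7, hp4, mul_smul_comm, smul_mul_assoc, smul_mul_assoc]
end

section
/- Under the coaction of the coloured quantum group on the coloured quantum plane, the second plane relation is preserved: x'_λ y'_μ = q^{1−λ−μ} y'_μ x'_λ. -/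
/-- Under the coaction of `GL_q^{λ,μ}(2)` on the coloured quantum plane, the second plane relation is preserved: `x'_λ y'_μ = q^{1−λ−μ} y'_μ x'_λ`. -/
theorem coaction_preserves_plane_rel_xy {A : Type*} [Ring A] [Algebra ℝ A]
    (q : ℝ) (hq : 0 < q) (l m : ℝ)
    (al bl cl dl am bm cm dm : A) (xl yl xm ym : A)
    (h1 : al * bm = q ^ (1 + 2*l) • (bm * al))
    (h2 : al * cm = q ^ (1 - 2*l) • (cm * al))
    (h3 : bl * cm = q ^ (-(2*(l + m))) • (cm * bl))
    (h4 : bl * dm = q ^ (1 - 2*m) • (dm * bl))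
    (h5 : dl * cm = q ^ (-1 - 2*l) • (cm * dl))
    (h6 : al * dm - dm * al = ((q - q⁻¹) * q ^ (l + m)) • (bm * cl))
    (h7 : al * bm = q ^ (l - m) • (am * bl))
    (h8 : al * cm = q ^ (m - l) • (am * cl))
    (h9 : bl * cm = bm * cl)
    (h10 : bl * dm = q ^ (l - m) • (bm * dl))
    (h11 : cl * dm = q ^ (m - l) • (cm * dl))
    (h12 : al * dm = am * dl)
    (h13 : al * am = am * al)
    (h14 : bl * bm = q ^ (2*(l - m)) • (bm * bl))
    (h15 : cl * cm = q ^ (2*(m - l)) • (cm * cl))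
    (h16 : dl * dm = dm * dl)
    (h17 : am * bl = q ^ (1 + 2*m) • (bl * am))
    (h18 : am * cl = q ^ (1 - 2*m) • (cl * am))
    (h19 : bm * cl = q ^ (-(2*(m + l))) • (cl * bm))
    (h20 : bm * dl = q ^ (1 - 2*l) • (dl * bm))
    (h21 : dm * cl = q ^ (-1 - 2*m) • (cl * dm))
    (h22 : am * dl - dl * am = ((q - q⁻¹) * q ^ (m + l)) • (bl * cm))
    (h23 : am * bl = q ^ (m - l) • (al * bm))
    (h24 : am * cl = q ^ (l - m) • (al * cm))
    (h25 : bm * cl = bl * cm)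
    (h26 : bm * dl = q ^ (m - l) • (bl * dm))
    (h27 : cm * dl = q ^ (l - m) • (cl * dm))
    (h28 : am * dl = al * dm)
    (h29 : am * al = al * am)
    (h30 : bm * bl = q ^ (2*(m - l)) • (bl * bm))
    (h31 : cm * cl = q ^ (2*(l - m)) • (cl * cm))
    (h32 : dm * dl = dl * dm)
    (hp1 : xl * xm = q ^ (l - m) • (xm * xl))
    (hp2 : xl * ym = q ^ (1 - l - m) • (ym * xl))
    (hp3 : xm * yl = q ^ (1 - l - m) • (yl * xm))
    (hp4 : xl * ym = xm * yl)
    (hp5 : yl * ym = q ^ (m - l) • (ym * yl))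
    (hcomm : ∀ g ∈ ({al, bl, cl, dl, am, bm, cm, dm} : Set A),
      ∀ z ∈ ({xl, yl, xm, ym} : Set A), Commute g z) :
    (al * xl + bl * yl) * (cm * xm + dm * ym) = q ^ (1 - l - m) • ((cm * xm + dm * ym) * (al * xl + bl * yl)) := by
  have commutes : ∀ g ∈ ({al, bl, cl, dl, am, bm, cm, dm} : Set A),
      ∀ z ∈ ({xl, yl, xm, ym} : Set A), ∀ f w : A, f * z * (g * w) = f * g * (z * w) := by
    intro g hg z hz f w
    rw [mul_assoc, ← mul_assoc z, ← (hcomm g hg z hz).eq]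
    simp only [mul_assoc]
  have xx_coeff : q ^ (1 - 2*l) * q ^ (l - m) = q ^ (1 - l - m) := by
    rw [← Real.rpow_add hq]; ring_nf
  have yy_coeff : q ^ (1 - 2*m) * q ^ (m - l) = q ^ (1 - l - m) := by
    rw [← Real.rpow_add hq]; ring_nf
  have cross_coeff : (q - q⁻¹) * q ^ (l + m) * q ^ (1 - l - m) + 1
      = q ^ (1 - l - m) * q ^ (1 - l - m) * q ^ (2*(l + m)) := by
    have rpow_mul_rpow : q ^ (l + m) * q ^ (1 - l - m) = q := by
      rw [← Real.rpow_add hq]; ring_nf; exact Real.rpow_one q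
    have htwo : q ^ (2*(l + m)) = q ^ (l + m) * q ^ (l + m) := by
      rw [← Real.rpow_add hq]; ring_nf
    rw [htwo]
    linear_combination (-q⁻¹ - q ^ (l + m) * q ^ (1 - l - m)) * rpow_mul_rpow
      - inv_mul_cancel₀ hq.ne'
  have hcb : cm * bl = q ^ (2*(l + m)) • (bl * cm) := by
    rw [h3, smul_smul, ← Real.rpow_add hq, add_neg_cancel, Real.rpow_zero, one_smul]
  have had : al * dm = dm * al + ((q - q⁻¹) * q ^ (l + m)) • (bl * cm) := by
    rw [h9, ← h6]; abel
  have hyx : ym * xl = yl * xm := by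
    have h := hp2.symm.trans (hp4.trans hp3)
    exact smul_right_injective A (Real.rpow_pos_of_pos hq _).ne' h
  have cross : (al * dm) * (xl * ym) + (bl * cm) * (yl * xm)
      = q ^ (1 - l - m) • ((cm * bl) * (xm * yl) + (dm * al) * (ym * xl)) := by
    rw [hp4, hp3, hyx, hcb, had]
    simp only [add_mul, smul_mul_assoc, mul_smul_comm, smul_add, smul_smul]
    rw [add_assoc, add_comm]
    congr 1
    nth_rewrite 2 [← one_smul ℝ (bl * cm * (yl * xm))]
    rw [← add_smul]
    congr 1
    linear_combination cross_coeff
  have expand_left : (al * xl + bl * yl) * (cm * xm + dm * ym)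
      = (al * cm) * (xl * xm) + ((al * dm) * (xl * ym) + (bl * cm) * (yl * xm))
        + (bl * dm) * (yl * ym) := by
    simp only [add_mul, mul_add]
    rw [commutes cm (by simp) xl (by simp), commutes dm (by simp) xl (by simp),
      commutes cm (by simp) yl (by simp), commutes dm (by simp) yl (by simp)]
    abel
  have expand_right : (cm * xm + dm * ym) * (al * xl + bl * yl)
      = (cm * al) * (xm * xl) + ((cm * bl) * (xm * yl) + (dm * al) * (ym * xl))
        + (dm * bl) * (ym * yl) := by
    simp only [add_mul, mul_add]
    rw [commutes al (by simp) xm (by simp), commutes bl (by simp) xm (by simp),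
      commutes al (by simp) ym (by simp), commutes bl (by simp) ym (by simp)]
    abel
  rw [expand_left, expand_right, cross, h2, hp1, h4, hp5]
  simp only [smul_mul_smul_comm, xx_coeff, yy_coeff, smul_add]
end

section
/- Under the coaction of the coloured quantum group on the coloured quantum plane, the colour-exchange plane relation is preserved: x'_λ y'_μ = x'_μ y'_λ. -/
/-- Under the coaction of `GL_q^{λ,μ}(2)` on the coloured quantum plane, the colour-exchange plane relation is preserved: `x'_λ y'_μ = x'_μ y'_λ`. -/
theorem coaction_preserves_plane_rel_exchange {A : Type*} [Ring A] [Algebra ℝ A]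
    (q : ℝ) (hq : 0 < q) (l m : ℝ)
    (al bl cl dl am bm cm dm : A) (xl yl xm ym : A)
    (h1 : al * bm = q ^ (1 + 2*l) • (bm * al))
    (h2 : al * cm = q ^ (1 - 2*l) • (cm * al))
    (h3 : bl * cm = q ^ (-(2*(l + m))) • (cm * bl))
    (h4 : bl * dm = q ^ (1 - 2*m) • (dm * bl))
    (h5 : dl * cm = q ^ (-1 - 2*l) • (cm * dl))
    (h6 : al * dm - dm * al = ((q - q⁻¹) * q ^ (l + m)) • (bm * cl))
    (h7 : al * bm = q ^ (l - m) • (am * bl))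
    (h8 : al * cm = q ^ (m - l) • (am * cl))
    (h9 : bl * cm = bm * cl)
    (h10 : bl * dm = q ^ (l - m) • (bm * dl))
    (h11 : cl * dm = q ^ (m - l) • (cm * dl))
    (h12 : al * dm = am * dl)
    (h13 : al * am = am * al)
    (h14 : bl * bm = q ^ (2*(l - m)) • (bm * bl))
    (h15 : cl * cm = q ^ (2*(m - l)) • (cm * cl))
    (h16 : dl * dm = dm * dl)
    (h17 : am * bl = q ^ (1 + 2*m) • (bl * am))
    (h18 : am * cl = q ^ (1 - 2*m) • (cl * am))
    (h19 : bm * cl = q ^ (-(2*(m + l))) • (cl * bm))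
    (h20 : bm * dl = q ^ (1 - 2*l) • (dl * bm))
    (h21 : dm * cl = q ^ (-1 - 2*m) • (cl * dm))
    (h22 : am * dl - dl * am = ((q - q⁻¹) * q ^ (m + l)) • (bl * cm))
    (h23 : am * bl = q ^ (m - l) • (al * bm))
    (h24 : am * cl = q ^ (l - m) • (al * cm))
    (h25 : bm * cl = bl * cm)
    (h26 : bm * dl = q ^ (m - l) • (bl * dm))
    (h27 : cm * dl = q ^ (l - m) • (cl * dm))
    (h28 : am * dl = al * dm)
    (h29 : am * al = al * am)
    (h30 : bm * bl = q ^ (2*(m - l)) • (bl * bm))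
    (h31 : cm * cl = q ^ (2*(l - m)) • (cl * cm))
    (h32 : dm * dl = dl * dm)
    (hp1 : xl * xm = q ^ (l - m) • (xm * xl))
    (hp2 : xl * ym = q ^ (1 - l - m) • (ym * xl))
    (hp3 : xm * yl = q ^ (1 - l - m) • (yl * xm))
    (hp4 : xl * ym = xm * yl)
    (hp5 : yl * ym = q ^ (m - l) • (ym * yl))
    (hcomm : ∀ g ∈ ({al, bl, cl, dl, am, bm, cm, dm} : Set A),
      ∀ z ∈ ({xl, yl, xm, ym} : Set A), Commute g z) :
    (al * xl + bl * yl) * (cm * xm + dm * ym) = (am * xm + bm * ym) * (cl * xl + dl * yl) := by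
  have hne : q ^ (1 - l - m) ≠ 0 := (Real.rpow_pos_of_pos hq _).ne'
  have hyx : yl * xm = ym * xl :=
    smul_right_injective A hne (hp3.symm.trans (hp4.symm.trans hp2))
  have hpow : q ^ (l - m) * q ^ (m - l) = 1 := by
    rw [← Real.rpow_add hq, sub_add_sub_cancel, sub_self, Real.rpow_zero]
  have hpow' : q ^ (m - l) * q ^ (l - m) = 1 := by rw [mul_comm, hpow]
  have swap : ∀ f w : A, ∀ g ∈ ({al, bl, cl, dl, am, bm, cm, dm} : Set A),
      ∀ z ∈ ({xl, yl, xm, ym} : Set A), f * z * (g * w) = f * g * (z * w) :=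
    fun f w g hg z hz => (hcomm g hg z hz).symm.mul_mul_mul_comm f w
  have hxx : al * xl * (cm * xm) = am * xm * (cl * xl) := by
    rw [swap _ _ cm (by simp) xl (by simp), swap _ _ cl (by simp) xm (by simp), h8, hp1,
      smul_mul_smul_comm, hpow', one_smul]
  have hxy : al * xl * (dm * ym) = am * xm * (dl * yl) := by
    rw [swap _ _ dm (by simp) xl (by simp), swap _ _ dl (by simp) xm (by simp), h12, hp4]
  have hyx' : bl * yl * (cm * xm) = bm * ym * (cl * xl) := by
    rw [swap _ _ cm (by simp) yl (by simp), swap _ _ cl (by simp) ym (by simp), h9, hyx]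
  have hyy : bl * yl * (dm * ym) = bm * ym * (dl * yl) := by
    rw [swap _ _ dm (by simp) yl (by simp), swap _ _ dl (by simp) ym (by simp), h10, hp5,
      smul_mul_smul_comm, hpow, one_smul]
  simp only [add_mul, mul_add, hxx, hxy, hyx', hyy]
end

section
/- Under the coaction of the coloured quantum group on the coloured quantum plane, the last plane relation is preserved: y'_λ y'_μ = q^{μ−λ} y'_μ y'_λ. -/
/-- Proportionality `g h = r g' h'` and `z w = s z' w'` multiplies when the inner factors commute. -/
lemma smul_regroup_of_mul_eq_smul {R A : Type*} [CommSemiring R] [Semiring A] [Algebra R A]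
    {g h g' h' z w z' w' : A} {r s t : R} (hhz : Commute h z) (hhz' : Commute h' z')
    (hg : g * h = r • (g' * h')) (hz : z * w = s • (z' * w')) (ht : r * s = t) :
    g * z * (h * w) = t • (g' * z' * (h' * w')) := by
  rw [hhz.symm.mul_mul_mul_comm, hhz'.symm.mul_mul_mul_comm, hg, hz, smul_mul_smul_comm, ht]

/-- Under the coaction of `GL_q^{λ,μ}(2)` on the coloured quantum plane, the last plane relation is preserved: `y'_λ y'_μ = q^{μ−λ} y'_μ y'_λ`. -/
theorem coaction_preserves_plane_rel_yy {A : Type*} [Ring A] [Algebra ℝ A]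
    (q : ℝ) (hq : 0 < q) (l m : ℝ)
    (al bl cl dl am bm cm dm : A) (xl yl xm ym : A)
    (h1 : al * bm = q ^ (1 + 2*l) • (bm * al))
    (h2 : al * cm = q ^ (1 - 2*l) • (cm * al))
    (h3 : bl * cm = q ^ (-(2*(l + m))) • (cm * bl))
    (h4 : bl * dm = q ^ (1 - 2*m) • (dm * bl))
    (h5 : dl * cm = q ^ (-1 - 2*l) • (cm * dl))
    (h6 : al * dm - dm * al = ((q - q⁻¹) * q ^ (l + m)) • (bm * cl))
    (h7 : al * bm = q ^ (l - m) • (am * bl))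
    (h8 : al * cm = q ^ (m - l) • (am * cl))
    (h9 : bl * cm = bm * cl)
    (h10 : bl * dm = q ^ (l - m) • (bm * dl))
    (h11 : cl * dm = q ^ (m - l) • (cm * dl))
    (h12 : al * dm = am * dl)
    (h13 : al * am = am * al)
    (h14 : bl * bm = q ^ (2*(l - m)) • (bm * bl))
    (h15 : cl * cm = q ^ (2*(m - l)) • (cm * cl))
    (h16 : dl * dm = dm * dl)
    (h17 : am * bl = q ^ (1 + 2*m) • (bl * am))
    (h18 : am * cl = q ^ (1 - 2*m) • (cl * am))
    (h19 : bm * cl = q ^ (-(2*(m + l))) • (cl * bm))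
    (h20 : bm * dl = q ^ (1 - 2*l) • (dl * bm))
    (h21 : dm * cl = q ^ (-1 - 2*m) • (cl * dm))
    (h22 : am * dl - dl * am = ((q - q⁻¹) * q ^ (m + l)) • (bl * cm))
    (h23 : am * bl = q ^ (m - l) • (al * bm))
    (h24 : am * cl = q ^ (l - m) • (al * cm))
    (h25 : bm * cl = bl * cm)
    (h26 : bm * dl = q ^ (m - l) • (bl * dm))
    (h27 : cm * dl = q ^ (l - m) • (cl * dm))
    (h28 : am * dl = al * dm)
    (h29 : am * al = al * am)
    (h30 : bm * bl = q ^ (2*(m - l)) • (bl * bm))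
    (h31 : cm * cl = q ^ (2*(l - m)) • (cl * cm))
    (h32 : dm * dl = dl * dm)
    (hp1 : xl * xm = q ^ (l - m) • (xm * xl))
    (hp2 : xl * ym = q ^ (1 - l - m) • (ym * xl))
    (hp3 : xm * yl = q ^ (1 - l - m) • (yl * xm))
    (hp4 : xl * ym = xm * yl)
    (hp5 : yl * ym = q ^ (m - l) • (ym * yl))
    (hcomm : ∀ g ∈ ({al, bl, cl, dl, am, bm, cm, dm} : Set A),
      ∀ z ∈ ({xl, yl, xm, ym} : Set A), Commute g z) :
    (cl * xl + dl * yl) * (cm * xm + dm * ym) = q ^ (m - l) • ((cm * xm + dm * ym) * (cl * xl + dl * yl)) := by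
  have hyx : yl * xm = ym * xl := by
    have h : q ^ (1 - l - m) • (yl * xm) = q ^ (1 - l - m) • (ym * xl) := by
      rw [← hp3, ← hp2, hp4]
    exact (smul_right_injective A (Real.rpow_pos_of_pos hq _).ne') h
  have hdc : dl * cm = q ^ (m - l) • (dm * cl) := by
    rw [h5, h27, h21, smul_smul, smul_smul, ← Real.rpow_add hq, ← Real.rpow_add hq]
    ring_nf
  have hcc : cl * xl * (cm * xm) = q ^ (m - l) • (cm * xm * (cl * xl)) :=
    smul_regroup_of_mul_eq_smul (hcomm _ (by simp) _ (by simp)) (hcomm _ (by simp) _ (by simp))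
      h15 hp1 (by rw [← Real.rpow_add hq]; ring_nf)
  have hcd : cl * xl * (dm * ym) = q ^ (m - l) • (cm * xm * (dl * yl)) :=
    smul_regroup_of_mul_eq_smul (hcomm _ (by simp) _ (by simp)) (hcomm _ (by simp) _ (by simp))
      h11 (hp4.trans (one_smul ℝ _).symm) (mul_one _)
  have hdcxy : dl * yl * (cm * xm) = q ^ (m - l) • (dm * ym * (cl * xl)) :=
    smul_regroup_of_mul_eq_smul (hcomm _ (by simp) _ (by simp)) (hcomm _ (by simp) _ (by simp))
      hdc (hyx.trans (one_smul ℝ _).symm) (mul_one _)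
  have hdd : dl * yl * (dm * ym) = q ^ (m - l) • (dm * ym * (dl * yl)) :=
    smul_regroup_of_mul_eq_smul (hcomm _ (by simp) _ (by simp)) (hcomm _ (by simp) _ (by simp))
      (h16.trans (one_smul ℝ _).symm) hp5 (one_mul _)
  simp only [add_mul, mul_add, smul_add, hcc, hcd, hdcxy, hdd]
end

section
/- Under the coaction of the coloured quantum group on the coloured quantum hyperplane, the Grassmann relation for ξ is preserved: ξ'_λ ξ'_μ = 0. -/
/-- Under the coaction of `GL_q^{λ,μ}(2)` on the coloured quantum hyperplane (with `ξ'_ν = a_ν ξ_ν + b_ν η_ν`, `η'_ν = c_ν ξ_ν + d_ν η_ν`), the Grassmann relation for ξ is preserved: `ξ'_λ ξ'_μ = 0`. -/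
theorem coaction_preserves_hyperplane_xi {A : Type*} [Ring A] [Algebra ℝ A]
    (q : ℝ) (hq : 0 < q) (l m : ℝ)
    (al bl cl dl am bm cm dm : A) (xil etal xim etam : A)
    (h1 : al * bm = q ^ (1 + 2*l) • (bm * al))
    (h2 : al * cm = q ^ (1 - 2*l) • (cm * al))
    (h3 : bl * cm = q ^ (-(2*(l + m))) • (cm * bl))
    (h4 : bl * dm = q ^ (1 - 2*m) • (dm * bl))
    (h5 : dl * cm = q ^ (-1 - 2*l) • (cm * dl))
    (h6 : al * dm - dm * al = ((q - q⁻¹) * q ^ (l + m)) • (bm * cl))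
    (h7 : al * bm = q ^ (l - m) • (am * bl))
    (h8 : al * cm = q ^ (m - l) • (am * cl))
    (h9 : bl * cm = bm * cl)
    (h10 : bl * dm = q ^ (l - m) • (bm * dl))
    (h11 : cl * dm = q ^ (m - l) • (cm * dl))
    (h12 : al * dm = am * dl)
    (h13 : al * am = am * al)
    (h14 : bl * bm = q ^ (2*(l - m)) • (bm * bl))
    (h15 : cl * cm = q ^ (2*(m - l)) • (cm * cl))
    (h16 : dl * dm = dm * dl)
    (h17 : am * bl = q ^ (1 + 2*m) • (bl * am))
    (h18 : am * cl = q ^ (1 - 2*m) • (cl * am))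
    (h19 : bm * cl = q ^ (-(2*(m + l))) • (cl * bm))
    (h20 : bm * dl = q ^ (1 - 2*l) • (dl * bm))
    (h21 : dm * cl = q ^ (-1 - 2*m) • (cl * dm))
    (h22 : am * dl - dl * am = ((q - q⁻¹) * q ^ (m + l)) • (bl * cm))
    (h23 : am * bl = q ^ (m - l) • (al * bm))
    (h24 : am * cl = q ^ (l - m) • (al * cm))
    (h25 : bm * cl = bl * cm)
    (h26 : bm * dl = q ^ (m - l) • (bl * dm))
    (h27 : cm * dl = q ^ (l - m) • (cl * dm))
    (h28 : am * dl = al * dm)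
    (h29 : am * al = al * am)
    (h30 : bm * bl = q ^ (2*(m - l)) • (bl * bm))
    (h31 : cm * cl = q ^ (2*(l - m)) • (cl * cm))
    (h32 : dm * dl = dl * dm)
    (hg1 : xil * xim = 0) (hg2 : xim * xil = 0)
    (hg3 : etal * etam = 0) (hg4 : etam * etal = 0)
    (hg5 : xil * etam = (-(q ^ (-(1 + l + m)))) • (etam * xil))
    (hg6 : xim * etal = (-(q ^ (-(1 + l + m)))) • (etal * xim))
    (hg7 : xil * etam = xim * etal)
    (hcomm : ∀ g ∈ ({al, bl, cl, dl, am, bm, cm, dm} : Set A),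
      ∀ z ∈ ({xil, etal, xim, etam} : Set A), Commute g z) :
    (al * xil + bl * etal) * (am * xim + bm * etam) = 0 := by
  have swap : ∀ {g z : A}, Commute g z → ∀ f w : A, f * z * (g * w) = f * g * (z * w) :=
    fun {g z} h f w => h.symm.mul_mul_mul_comm f w
  have hab : al * bm = q ^ (1 + l + m) • (bl * am) := by
    rw [h7, h17, smul_smul, ← Real.rpow_add hq]
    ring_nf
  have hxe : xil * etam = (-(q ^ (-(1 + l + m)))) • (etal * xim) := hg7.trans hg6
  have hpow : q ^ (1 + l + m) * q ^ (-(1 + l + m)) = 1 := by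
    rw [← Real.rpow_add hq, add_neg_cancel, Real.rpow_zero]
  rw [add_mul, mul_add, mul_add,
    swap (hcomm am (by simp) xil (by simp)), swap (hcomm bm (by simp) xil (by simp)),
    swap (hcomm am (by simp) etal (by simp)), swap (hcomm bm (by simp) etal (by simp)),
    hg1, hg3, hab, hxe, smul_mul_smul_comm, mul_neg, hpow]
  simp
end

section
/- Under the coaction of the coloured quantum group on the coloured quantum hyperplane, the Grassmann relation for η is preserved: η'_λ η'_μ = 0. -/
/-- Under the coaction of `GL_q^{λ,μ}(2)` on the coloured quantum hyperplane, the Grassmann relation for η is preserved: `η'_λ η'_μ = 0`. -/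
theorem coaction_preserves_hyperplane_eta {A : Type*} [Ring A] [Algebra ℝ A]
    (q : ℝ) (hq : 0 < q) (l m : ℝ)
    (al bl cl dl am bm cm dm : A) (xil etal xim etam : A)
    (h1 : al * bm = q ^ (1 + 2*l) • (bm * al))
    (h2 : al * cm = q ^ (1 - 2*l) • (cm * al))
    (h3 : bl * cm = q ^ (-(2*(l + m))) • (cm * bl))
    (h4 : bl * dm = q ^ (1 - 2*m) • (dm * bl))
    (h5 : dl * cm = q ^ (-1 - 2*l) • (cm * dl))
    (h6 : al * dm - dm * al = ((q - q⁻¹) * q ^ (l + m)) • (bm * cl))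
    (h7 : al * bm = q ^ (l - m) • (am * bl))
    (h8 : al * cm = q ^ (m - l) • (am * cl))
    (h9 : bl * cm = bm * cl)
    (h10 : bl * dm = q ^ (l - m) • (bm * dl))
    (h11 : cl * dm = q ^ (m - l) • (cm * dl))
    (h12 : al * dm = am * dl)
    (h13 : al * am = am * al)
    (h14 : bl * bm = q ^ (2*(l - m)) • (bm * bl))
    (h15 : cl * cm = q ^ (2*(m - l)) • (cm * cl))
    (h16 : dl * dm = dm * dl)
    (h17 : am * bl = q ^ (1 + 2*m) • (bl * am))
    (h18 : am * cl = q ^ (1 - 2*m) • (cl * am))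
    (h19 : bm * cl = q ^ (-(2*(m + l))) • (cl * bm))
    (h20 : bm * dl = q ^ (1 - 2*l) • (dl * bm))
    (h21 : dm * cl = q ^ (-1 - 2*m) • (cl * dm))
    (h22 : am * dl - dl * am = ((q - q⁻¹) * q ^ (m + l)) • (bl * cm))
    (h23 : am * bl = q ^ (m - l) • (al * bm))
    (h24 : am * cl = q ^ (l - m) • (al * cm))
    (h25 : bm * cl = bl * cm)
    (h26 : bm * dl = q ^ (m - l) • (bl * dm))
    (h27 : cm * dl = q ^ (l - m) • (cl * dm))
    (h28 : am * dl = al * dm)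
    (h29 : am * al = al * am)
    (h30 : bm * bl = q ^ (2*(m - l)) • (bl * bm))
    (h31 : cm * cl = q ^ (2*(l - m)) • (cl * cm))
    (h32 : dm * dl = dl * dm)
    (hg1 : xil * xim = 0) (hg2 : xim * xil = 0)
    (hg3 : etal * etam = 0) (hg4 : etam * etal = 0)
    (hg5 : xil * etam = (-(q ^ (-(1 + l + m)))) • (etam * xil))
    (hg6 : xim * etal = (-(q ^ (-(1 + l + m)))) • (etal * xim))
    (hg7 : xil * etam = xim * etal)
    (hcomm : ∀ g ∈ ({al, bl, cl, dl, am, bm, cm, dm} : Set A),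
      ∀ z ∈ ({xil, etal, xim, etam} : Set A), Commute g z) :
    (cl * xil + dl * etal) * (cm * xim + dm * etam) = 0 := by
  have c1 : Commute cm xil := hcomm _ (by simp) _ (by simp)
  have c2 : Commute dm xil := hcomm _ (by simp) _ (by simp)
  have c3 : Commute cm etal := hcomm _ (by simp) _ (by simp)
  have c4 : Commute dm etal := hcomm _ (by simp) _ (by simp)
  have cross : cl * dm * (xil * etam) = -(dl * cm * (etal * xim)) := by
    rw [hg7, hg6, h11, h5, smul_mul_smul_comm, smul_mul_assoc, mul_neg,
      ← Real.rpow_add hq, neg_smul]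
    ring_nf
  calc (cl * xil + dl * etal) * (cm * xim + dm * etam)
      = cl * (xil * cm) * xim + cl * (xil * dm) * etam
        + (dl * (etal * cm) * xim + dl * (etal * dm) * etam) := by noncomm_ring
    _ = cl * cm * (xil * xim) + cl * dm * (xil * etam)
        + (dl * cm * (etal * xim) + dl * dm * (etal * etam)) := by
      rw [← c1.eq, ← c2.eq, ← c3.eq, ← c4.eq]
      simp only [mul_assoc]
    _ = 0 := by
      rw [hg1, hg3, cross]
      simp
end

section
/- Under the coaction of the coloured quantum group on the coloured quantum hyperplane, the ξη anticommutation relation is preserved: ξ'_λ η'_μ = −q^{−(1+λ+μ)} η'_μ ξ'_λ. -/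
/-- Elements that commute past each other in the middle allow a product of products to be regrouped. -/
theorem Commute.mul_mul_mul_regroup {M : Type*} [Semigroup M] {g z : M} (h : Commute g z)
    (f w : M) : f * z * (g * w) = f * g * (z * w) := by
  rw [mul_assoc, ← mul_assoc z, ← h.eq, mul_assoc g, ← mul_assoc]

/-- Under the coaction of `GL_q^{λ,μ}(2)` on the coloured quantum hyperplane, the ξη anticommutation relation is preserved: `ξ'_λ η'_μ = −q^{−(1+λ+μ)} η'_μ ξ'_λ`. -/
theorem coaction_preserves_hyperplane_xieta {A : Type*} [Ring A] [Algebra ℝ A]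
    (q : ℝ) (hq : 0 < q) (l m : ℝ)
    (al bl cl dl am bm cm dm : A) (xil etal xim etam : A)
    (h1 : al * bm = q ^ (1 + 2*l) • (bm * al))
    (h2 : al * cm = q ^ (1 - 2*l) • (cm * al))
    (h3 : bl * cm = q ^ (-(2*(l + m))) • (cm * bl))
    (h4 : bl * dm = q ^ (1 - 2*m) • (dm * bl))
    (h5 : dl * cm = q ^ (-1 - 2*l) • (cm * dl))
    (h6 : al * dm - dm * al = ((q - q⁻¹) * q ^ (l + m)) • (bm * cl))
    (h7 : al * bm = q ^ (l - m) • (am * bl))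
    (h8 : al * cm = q ^ (m - l) • (am * cl))
    (h9 : bl * cm = bm * cl)
    (h10 : bl * dm = q ^ (l - m) • (bm * dl))
    (h11 : cl * dm = q ^ (m - l) • (cm * dl))
    (h12 : al * dm = am * dl)
    (h13 : al * am = am * al)
    (h14 : bl * bm = q ^ (2*(l - m)) • (bm * bl))
    (h15 : cl * cm = q ^ (2*(m - l)) • (cm * cl))
    (h16 : dl * dm = dm * dl)
    (h17 : am * bl = q ^ (1 + 2*m) • (bl * am))
    (h18 : am * cl = q ^ (1 - 2*m) • (cl * am))
    (h19 : bm * cl = q ^ (-(2*(m + l))) • (cl * bm))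
    (h20 : bm * dl = q ^ (1 - 2*l) • (dl * bm))
    (h21 : dm * cl = q ^ (-1 - 2*m) • (cl * dm))
    (h22 : am * dl - dl * am = ((q - q⁻¹) * q ^ (m + l)) • (bl * cm))
    (h23 : am * bl = q ^ (m - l) • (al * bm))
    (h24 : am * cl = q ^ (l - m) • (al * cm))
    (h25 : bm * cl = bl * cm)
    (h26 : bm * dl = q ^ (m - l) • (bl * dm))
    (h27 : cm * dl = q ^ (l - m) • (cl * dm))
    (h28 : am * dl = al * dm)
    (h29 : am * al = al * am)
    (h30 : bm * bl = q ^ (2*(m - l)) • (bl * bm))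
    (h31 : cm * cl = q ^ (2*(l - m)) • (cl * cm))
    (h32 : dm * dl = dl * dm)
    (hg1 : xil * xim = 0) (hg2 : xim * xil = 0)
    (hg3 : etal * etam = 0) (hg4 : etam * etal = 0)
    (hg5 : xil * etam = (-(q ^ (-(1 + l + m)))) • (etam * xil))
    (hg6 : xim * etal = (-(q ^ (-(1 + l + m)))) • (etal * xim))
    (hg7 : xil * etam = xim * etal)
    (hcomm : ∀ g ∈ ({al, bl, cl, dl, am, bm, cm, dm} : Set A),
      ∀ z ∈ ({xil, etal, xim, etam} : Set A), Commute g z) :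
    (al * xil + bl * etal) * (cm * xim + dm * etam) = (-(q ^ (-(1 + l + m)))) • ((cm * xim + dm * etam) * (al * xil + bl * etal)) := by
  have hp : 0 < q ^ (l + m) := Real.rpow_pos_of_pos hq _
  have hk : q ^ (-(1 + l + m)) = q⁻¹ * (q ^ (l + m))⁻¹ := by
    rw [show -(1 + l + m) = -1 + -(l + m) by ring, Real.rpow_add hq, Real.rpow_neg_one,
      Real.rpow_neg hq.le]
  have hp2 : q ^ (-(2 * (l + m))) = (q ^ (l + m))⁻¹ * (q ^ (l + m))⁻¹ := by
    rw [show -(2 * (l + m)) = -(l + m) + -(l + m) by ring, Real.rpow_add hq, Real.rpow_neg hq.le]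
  rw [hk] at hg5 hg6 ⊢
  rw [hp2] at h3
  generalize q ^ (l + m) = p at *
  have hk0 : -(q⁻¹ * p⁻¹) ≠ 0 := by
    have := hq.ne'
    have := hp.ne'
    simp [*]
  have hY : etal * xim = etam * xil :=
    smul_right_injective A hk0 (hg6.symm.trans (hg7.symm.trans hg5))
  have had : al * dm = dm * al + ((q - q⁻¹) * p) • (bl * cm) := by
    rw [h9, ← h6]
    abel
  have hcb : cm * bl = (p * p) • (bl * cm) := by
    rw [h3, smul_smul, show p * p * (p⁻¹ * p⁻¹) = 1 by field_simp, one_smul]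
  have hcx : Commute cm xil := hcomm _ (by simp) _ (by simp)
  have hdx : Commute dm xil := hcomm _ (by simp) _ (by simp)
  have hce : Commute cm etal := hcomm _ (by simp) _ (by simp)
  have hde : Commute dm etal := hcomm _ (by simp) _ (by simp)
  have hax : Commute al xim := hcomm _ (by simp) _ (by simp)
  have hbx : Commute bl xim := hcomm _ (by simp) _ (by simp)
  have hae : Commute al etam := hcomm _ (by simp) _ (by simp)
  have hbe : Commute bl etam := hcomm _ (by simp) _ (by simp)
  simp only [add_mul, mul_add, hcx.mul_mul_mul_regroup, hdx.mul_mul_mul_regroup,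
    hce.mul_mul_mul_regroup, hde.mul_mul_mul_regroup, hax.mul_mul_mul_regroup,
    hbx.mul_mul_mul_regroup, hae.mul_mul_mul_regroup, hbe.mul_mul_mul_regroup]
  rw [hg1, hg2, hg3, hg4, ← hg7, hg5, hY, had, hcb]
  simp only [add_mul, smul_mul_assoc, mul_smul_comm, mul_zero]
  match_scalars <;> field_simp <;> ring
end

section
/- Under the coaction of the coloured quantum group on the coloured quantum hyperplane, the colour-exchange relation is preserved: ξ'_λ η'_μ = ξ'_μ η'_λ. -/
/-- Under the coaction of `GL_q^{λ,μ}(2)` on the coloured quantum hyperplane, the colour-exchange relation is preserved: `ξ'_λ η'_μ = ξ'_μ η'_λ`. -/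
theorem coaction_preserves_hyperplane_exchange {A : Type*} [Ring A] [Algebra ℝ A]
    (q : ℝ) (hq : 0 < q) (l m : ℝ)
    (al bl cl dl am bm cm dm : A) (xil etal xim etam : A)
    (h1 : al * bm = q ^ (1 + 2*l) • (bm * al))
    (h2 : al * cm = q ^ (1 - 2*l) • (cm * al))
    (h3 : bl * cm = q ^ (-(2*(l + m))) • (cm * bl))
    (h4 : bl * dm = q ^ (1 - 2*m) • (dm * bl))
    (h5 : dl * cm = q ^ (-1 - 2*l) • (cm * dl))
    (h6 : al * dm - dm * al = ((q - q⁻¹) * q ^ (l + m)) • (bm * cl))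
    (h7 : al * bm = q ^ (l - m) • (am * bl))
    (h8 : al * cm = q ^ (m - l) • (am * cl))
    (h9 : bl * cm = bm * cl)
    (h10 : bl * dm = q ^ (l - m) • (bm * dl))
    (h11 : cl * dm = q ^ (m - l) • (cm * dl))
    (h12 : al * dm = am * dl)
    (h13 : al * am = am * al)
    (h14 : bl * bm = q ^ (2*(l - m)) • (bm * bl))
    (h15 : cl * cm = q ^ (2*(m - l)) • (cm * cl))
    (h16 : dl * dm = dm * dl)
    (h17 : am * bl = q ^ (1 + 2*m) • (bl * am))
    (h18 : am * cl = q ^ (1 - 2*m) • (cl * am))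
    (h19 : bm * cl = q ^ (-(2*(m + l))) • (cl * bm))
    (h20 : bm * dl = q ^ (1 - 2*l) • (dl * bm))
    (h21 : dm * cl = q ^ (-1 - 2*m) • (cl * dm))
    (h22 : am * dl - dl * am = ((q - q⁻¹) * q ^ (m + l)) • (bl * cm))
    (h23 : am * bl = q ^ (m - l) • (al * bm))
    (h24 : am * cl = q ^ (l - m) • (al * cm))
    (h25 : bm * cl = bl * cm)
    (h26 : bm * dl = q ^ (m - l) • (bl * dm))
    (h27 : cm * dl = q ^ (l - m) • (cl * dm))
    (h28 : am * dl = al * dm)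
    (h29 : am * al = al * am)
    (h30 : bm * bl = q ^ (2*(m - l)) • (bl * bm))
    (h31 : cm * cl = q ^ (2*(l - m)) • (cl * cm))
    (h32 : dm * dl = dl * dm)
    (hg1 : xil * xim = 0) (hg2 : xim * xil = 0)
    (hg3 : etal * etam = 0) (hg4 : etam * etal = 0)
    (hg5 : xil * etam = (-(q ^ (-(1 + l + m)))) • (etam * xil))
    (hg6 : xim * etal = (-(q ^ (-(1 + l + m)))) • (etal * xim))
    (hg7 : xil * etam = xim * etal)
    (hcomm : ∀ g ∈ ({al, bl, cl, dl, am, bm, cm, dm} : Set A),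
      ∀ z ∈ ({xil, etal, xim, etam} : Set A), Commute g z) :
    (al * xil + bl * etal) * (cm * xim + dm * etam) = (am * xim + bm * etam) * (cl * xil + dl * etal) := by
  have hne : -(q ^ (-(1 + l + m))) ≠ 0 := neg_ne_zero.mpr (Real.rpow_pos_of_pos hq _).ne'
  have heta : etal * xim = etam * xil :=
    smul_right_injective A hne (hg6.symm.trans (hg7.symm.trans hg5))
  have hswap : ∀ g ∈ ({al, bl, cl, dl, am, bm, cm, dm} : Set A),
      ∀ z ∈ ({xil, etal, xim, etam} : Set A), ∀ x y : A, x * z * (g * y) = x * g * (z * y) :=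
    fun g hg z hz x y => (hcomm g hg z hz).symm.mul_mul_mul_comm x y
  simp only [add_mul, mul_add]
  rw [hswap cm (by simp) xil (by simp), hswap dm (by simp) xil (by simp),
    hswap cm (by simp) etal (by simp), hswap dm (by simp) etal (by simp),
    hswap cl (by simp) xim (by simp), hswap dl (by simp) xim (by simp),
    hswap cl (by simp) etam (by simp), hswap dl (by simp) etam (by simp),
    hg1, hg2, hg3, hg4, h12, h9, hg7, heta]
  simp only [mul_zero, zero_add, add_zero]
end

section
/- Let A be an associative unital ℝ-algebra, q > 0 real with q ≠ 1, h ∈ ℝ, and λ, μ ∈ ℝ. Suppose x_λ, y_λ, x_μ, y_μ ∈ A satisfy the coloured quantum plane relations x_λ y_μ = q^{1−λ−μ} y_μ x_λ and y_λ y_μ = q^{μ−λ} y_μ y_λ. Define the contracted coordinates x'_ν = x_ν + (h/(1−q))·y_ν and y'_ν = y_ν for ν ∈ {λ, μ}. Then the coloured (q,h)-plane relation holds: x'_λ y'_μ − q^{1−λ−μ} y'_μ x'_λ = h·[1−2μ]_q · y'_λ y'_μ, where [s]_q := (1 − q^s)/(1 − q) is the q-basic number. -/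
/-- Contraction of the coloured `q`-plane: with contracted coordinates
`x'_ν = x_ν + (h/(1−q))·y_ν`, `y'_ν = y_ν`, the coloured `(q,h)`-plane relation
`x'_λ y'_μ − q^{1−λ−μ} y'_μ x'_λ = h·[1−2μ]_q · y'_λ y'_μ` holds, where
`[s]_q = (1 − q^s)/(1 − q)` is the q-basic number. -/
theorem coloured_qh_plane_relation {A : Type*} [Ring A] [Algebra ℝ A]
    (q : ℝ) (hq : 0 < q) (hq1 : q ≠ 1) (h l m : ℝ) (xl yl xm ym : A)
    (hp2 : xl * ym = q ^ (1 - l - m) • (ym * xl))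
    (hp5 : yl * ym = q ^ (m - l) • (ym * yl)) :
    (xl + (h / (1 - q)) • yl) * ym - q ^ (1 - l - m) • (ym * (xl + (h / (1 - q)) • yl)) =
      (h * ((1 - q ^ (1 - 2*m)) / (1 - q))) • (yl * ym) := by
  have hpow : q ^ (1 - l - m) = q ^ (1 - 2*m) * q ^ (m - l) := by
    rw [← Real.rpow_add hq]
    congr 1
    ring
  rw [add_mul, mul_add, smul_mul_assoc, mul_smul_comm, hp2, hp5, hpow]
  module
end

section
/- Let A be an associative unital ℝ-algebra, q > 0 real, λ ∈ ℝ, and let ξ, η, ∂x, ∂y ∈ A satisfy the single-colour relations of the differential calculus on the coloured quantum plane: ξ² = 0, η² = 0, ξ η = −q^{−(1+2λ)} η ξ, ∂x ∂y = q^{−(1+2λ)} ∂y ∂x, ∂x ξ = q^{−2} ξ ∂x, ∂x η = q^{−(1−2λ)} η ∂x, ∂y ξ = q^{−(1+2λ)} ξ ∂y, and ∂y η = q^{−2} η ∂y + (q^{−2} − 1) ξ ∂x. Then the exterior differential d = ξ ∂x + η ∂y is nilpotent: (ξ ∂x + η ∂y)² = 0. -/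
/-- For the single-colour Wess–Zumino-type calculus on the coloured quantum plane,
with differentials `ξ = dx_λ`, `η = dy_λ` and derivatives `∂x`, `∂y` satisfying the
listed commutation relations, the exterior differential `d = ξ ∂x + η ∂y` is
nilpotent: `d² = 0`. -/
theorem coloured_exterior_differential_nilpotent {A : Type*} [Ring A] [Algebra ℝ A]
    (q : ℝ) (hq : 0 < q) (l : ℝ) (xi eta px py : A)
    (h1 : xi * xi = 0)
    (h2 : eta * eta = 0)
    (h3 : xi * eta = (-(q ^ (-(1 + 2*l)))) • (eta * xi))
    (h4 : px * py = q ^ (-(1 + 2*l)) • (py * px))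
    (h5 : px * xi = q ^ (-2 : ℝ) • (xi * px))
    (h6 : px * eta = q ^ (-(1 - 2*l)) • (eta * px))
    (h7 : py * xi = q ^ (-(1 + 2*l)) • (xi * py))
    (h8 : py * eta = q ^ (-2 : ℝ) • (eta * py) + (q ^ (-2 : ℝ) - 1) • (xi * px)) :
    (xi * px + eta * py) * (xi * px + eta * py) = 0 := by
  have hc : q ^ (-2 : ℝ) = q ^ (-(1 + 2*l)) * q ^ (-(1 - 2*l)) := by
    rw [← Real.rpow_add hq]
    ring_nf
  rw [hc] at h5 h8
  generalize q ^ (-(1 + 2*l)) = a at *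
  generalize q ^ (-(1 - 2*l)) = b at *
  have hxx : xi * px * (xi * px) = 0 := by
    rw [mul_assoc, ← mul_assoc px, h5, smul_mul_assoc, mul_smul_comm, mul_assoc xi px,
      ← mul_assoc xi xi, h1, zero_mul, smul_zero]
  have hxy : xi * px * (eta * py) = (-(a * b * a)) • (eta * xi * (py * px)) := by
    rw [mul_assoc, ← mul_assoc px, h6, smul_mul_assoc, mul_smul_comm, mul_assoc eta px,
      ← mul_assoc xi eta, h3, h4, smul_mul_assoc, mul_smul_comm, smul_smul, smul_smul]
    congr 1
    ring
  have hyx : eta * py * (xi * px) = a • (eta * xi * (py * px)) := by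
    rw [mul_assoc, ← mul_assoc py, h7, smul_mul_assoc, mul_smul_comm, mul_assoc xi py,
      ← mul_assoc eta xi]
  have hyy : eta * py * (eta * py) = ((a * b - 1) * a) • (eta * xi * (py * px)) := by
    rw [mul_assoc, ← mul_assoc py, h8, add_mul, mul_add, smul_mul_assoc, smul_mul_assoc,
      mul_smul_comm, mul_smul_comm, mul_assoc eta py, ← mul_assoc eta eta, h2, zero_mul,
      smul_zero, zero_add, mul_assoc xi px, ← mul_assoc eta xi, h4, mul_smul_comm, smul_smul]
  rw [add_mul, mul_add, mul_add, hxx, hxy, hyx, hyy]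
  module
end
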